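/- Let F be the fermionic Fock space of the bc-system and let L_m and W̃_m (m ∈ ℤ) be the operators defined in the context. Then for all m, n ∈ ℤ, L_m ∘ W̃_n − W̃_n ∘ L_m = (2m − n)·W̃_{m+n} as operators on F (i.e., W̃(z) is a primary field of conformal weight 3 for the Virasoro field T(z)). -/

import Mathlib

noncomputable section

open ExteriorAlgebra

/-- Index type for the basis of `V`: `Sum.inl n` corresponds to `v_n` (`n ≥ 0`),
and `Sum.inr n` corresponds to `w_{n+1}` (so the `w_k` for `k ≥ 1`). -/
abbrev BCIndex : Type := ℕ ⊕ ℕ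

/-- The vector space `V` with basis `{v_n : n ≥ 0} ∪ {w_n : n ≥ 1}`. -/
abbrev BCSpace : Type := BCIndex →₀ ℂ

/-- The fermionic Fock space: the exterior algebra of `V`. -/
abbrev FockF : Type := ExteriorAlgebra ℂ BCSpace

/-- The basis vector of `V` with index `i`. -/
def bv (i : BCIndex) : BCSpace := Finsupp.single i 1

/-- The linear functional sending the basis vector `i` to `1` and all others to `0`. -/
def bvDual (i : BCIndex) : Module.Dual ℂ BCSpace := Finsupp.lapply i

/-- The operator `b(n)`: for `n ≤ 0` left exterior multiplication by `v_{-n}`,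
for `n ≥ 1` contraction with the functional dual to `w_n`. -/
def bOp (n : ℤ) : Module.End ℂ FockF :=
  if n ≤ 0 then LinearMap.mulLeft ℂ (ι ℂ (bv (Sum.inl (-n).toNat)))
  else CliffordAlgebra.contractLeft (bvDual (Sum.inr (n - 1).toNat))

/-- The operator `c(n)`: for `n ≥ 0` contraction with the functional dual to `v_n`,
for `n ≤ -1` left exterior multiplication by `w_{-n}`. -/
def cOp (n : ℤ) : Module.End ℂ FockF :=
  if 0 ≤ n then CliffordAlgebra.contractLeft (bvDual (Sum.inl n.toNat))
  else LinearMap.mulLeft ℂ (ι ℂ (bv (Sum.inr (-n - 1).toNat)))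

/-- The normally ordered product `:b(k)c(j):`. -/
def nbc (k j : ℤ) : Module.End ℂ FockF :=
  if 1 ≤ k ∧ j ≤ -1 then -(cOp j ∘ₗ bOp k) else bOp k ∘ₗ cOp j

/-- The Virasoro modes `L_m` of `T(z) = :∂b(z)c(z):`,
`L_m x = Σ_k (−k)·:b(k)c(m−k):·x` (a finite sum on each `x`). -/
def Lmode (m : ℤ) (x : FockF) : FockF :=
  ∑ᶠ k : ℤ, (-k : ℂ) • nbc k (m - k) x

/-- The modes `W̃_m` of `W̃(z) = (1/2)(:∂²b(z)c(z): − :∂b(z)∂c(z):)`,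
`W̃_m x = (1/2)Σ_k k(2k−m)·:b(k)c(m−k):·x` (a finite sum on each `x`). -/
def Wmode (m : ℤ) (x : FockF) : FockF :=
  ∑ᶠ k : ℤ, ((1 / 2 : ℂ) * k * (2 * k - m)) • nbc k (m - k) x

/-- The charge of a list of basis indices: (number of `v`-type) − (number of `w`-type). -/
def chargeOf (L : List BCIndex) : ℤ :=
  (L.countP Sum.isLeft : ℤ) - (L.countP Sum.isRight : ℤ)

/-- `F^l`: the span of the wedge monomials of charge `l`. -/
def FF (l : ℤ) : Submodule ℂ FockF :=
  Submodule.span ℂ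
    {x | ∃ L : List BCIndex, chargeOf L = l ∧ x = (L.map fun i => ι ℂ (bv i)).prod}

/-- `F̄^l = {x ∈ F^l : c(0)x = 0}`. -/
def FFbar (l : ℤ) : Submodule ℂ FockF := FF l ⊓ LinearMap.ker (cOp 0)

theorem contractLeft_ι_bv (i j : BCIndex) (x : FockF) :
    CliffordAlgebra.contractLeft (bvDual i) (ι ℂ (bv j) * x) =
      (if j = i then (1 : ℂ) else 0) • x -
        ι ℂ (bv j) * CliffordAlgebra.contractLeft (bvDual i) x := by
  have h := CliffordAlgebra.contractLeft_ι_mul (Q := (0 : QuadraticForm ℂ BCSpace))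
    (d := bvDual i) (bv j) x
  refine h.trans ?_
  simp only [bvDual, bv, Finsupp.lapply_apply, Finsupp.single_apply]

theorem ι_mul_ι_mul (v w : BCSpace) (x : FockF) :
    ι ℂ v * (ι ℂ w * x) + ι ℂ w * (ι ℂ v * x) = 0 := by
  rw [← mul_assoc, ← mul_assoc, ← add_mul, ι_add_mul_swap, zero_mul]

/-- Creation operators `b(n)`, `n ≤ 0`. -/
theorem bOp_of_nonpos {n : ℤ} (h : n ≤ 0) (x : FockF) :
    bOp n x = ι ℂ (bv (Sum.inl (-n).toNat)) * x := by
  simp [bOp, h]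

/-- Annihilation operators `b(n)`, `n ≥ 1`. -/
theorem bOp_of_pos {n : ℤ} (h : 1 ≤ n) (x : FockF) :
    bOp n x = CliffordAlgebra.contractLeft (bvDual (Sum.inr (n - 1).toNat)) x := by
  simp [bOp, show ¬ n ≤ 0 by lia]

/-- Annihilation operators `c(n)`, `n ≥ 0`. -/
theorem cOp_of_nonneg {n : ℤ} (h : 0 ≤ n) (x : FockF) :
    cOp n x = CliffordAlgebra.contractLeft (bvDual (Sum.inl n.toNat)) x := by
  simp [cOp, h]

/-- Creation operators `c(n)`, `n ≤ -1`. -/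
theorem cOp_of_neg {n : ℤ} (h : n ≤ -1) (x : FockF) :
    cOp n x = ι ℂ (bv (Sum.inr (-n - 1).toNat)) * x := by
  simp [cOp, show ¬ 0 ≤ n by lia]

theorem bOp_cOp (m n : ℤ) (x : FockF) :
    bOp m (cOp n x) = (if m + n = 0 then (1 : ℂ) else 0) • x - cOp n (bOp m x) := by
  rcases le_or_gt m 0 with hm | hm <;> rcases le_or_gt 0 n with hn | hn
  · rw [bOp_of_nonpos hm, bOp_of_nonpos hm, cOp_of_nonneg hn, cOp_of_nonneg hn,
      contractLeft_ι_bv]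
    have : (Sum.inl (-m).toNat : BCIndex) = Sum.inl n.toNat ↔ m + n = 0 := by
      rw [Sum.inl.injEq]; lia
    simp only [this]
    abel
  · rw [bOp_of_nonpos hm, bOp_of_nonpos hm, cOp_of_neg (by lia), cOp_of_neg (by lia),
      if_neg (by lia), zero_smul, zero_sub]
    exact eq_neg_of_add_eq_zero_left (ι_mul_ι_mul _ _ _)
  · rw [bOp_of_pos (by lia), bOp_of_pos (by lia), cOp_of_nonneg hn, cOp_of_nonneg hn,
      if_neg (by lia), zero_smul, zero_sub, CliffordAlgebra.contractLeft_comm]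
  · rw [bOp_of_pos (by lia), bOp_of_pos (by lia), cOp_of_neg (by lia), cOp_of_neg (by lia),
      contractLeft_ι_bv]
    have : (Sum.inr (-n - 1).toNat : BCIndex) = Sum.inr (m - 1).toNat ↔ m + n = 0 := by
      rw [Sum.inr.injEq]; lia
    simp only [this]

theorem bOp_bOp (m n : ℤ) (x : FockF) : bOp m (bOp n x) = -bOp n (bOp m x) := by
  rcases le_or_gt m 0 with hm | hm <;> rcases le_or_gt n 0 with hn | hn
  · simp only [bOp_of_nonpos hm, bOp_of_nonpos hn]
    exact eq_neg_of_add_eq_zero_left (ι_mul_ι_mul _ _ _)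
  · simp only [bOp_of_nonpos hm, bOp_of_pos (show 1 ≤ n by lia), contractLeft_ι_bv]
    simp
  · simp only [bOp_of_nonpos hn, bOp_of_pos (show 1 ≤ m by lia), contractLeft_ι_bv]
    simp
  · simp only [bOp_of_pos (show 1 ≤ n by lia), bOp_of_pos (show 1 ≤ m by lia)]
    exact CliffordAlgebra.contractLeft_comm _ _ _

theorem cOp_cOp (m n : ℤ) (x : FockF) : cOp m (cOp n x) = -cOp n (cOp m x) := by
  rcases le_or_gt 0 m with hm | hm <;> rcases le_or_gt 0 n with hn | hn
  · simp only [cOp_of_nonneg hm, cOp_of_nonneg hn]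
    exact CliffordAlgebra.contractLeft_comm _ _ _
  · simp only [cOp_of_nonneg hm, cOp_of_neg (show n ≤ -1 by lia), contractLeft_ι_bv]
    simp
  · simp only [cOp_of_nonneg hn, cOp_of_neg (show m ≤ -1 by lia), contractLeft_ι_bv]
    simp
  · simp only [cOp_of_neg (show n ≤ -1 by lia), cOp_of_neg (show m ≤ -1 by lia)]
    exact eq_neg_of_add_eq_zero_left (ι_mul_ι_mul _ _ _)

/-- A bilinear normally ordered product differs from `b(k)c(j)` by a scalar. -/
theorem nbc_apply (k j : ℤ) (x : FockF) :
    nbc k j x = bOp k (cOp j x) -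
      (if 1 ≤ k ∧ j ≤ -1 ∧ k + j = 0 then (1 : ℂ) else 0) • x := by
  by_cases h : 1 ≤ k ∧ j ≤ -1
  · simp [nbc, h, bOp_cOp]
  · have : ¬ (1 ≤ k ∧ j ≤ -1 ∧ k + j = 0) := fun h' => h ⟨h'.1, h'.2.1⟩
    simp [nbc, h, this]

theorem nbc_bOp (k j n : ℤ) (x : FockF) :
    nbc k j (bOp n x) = bOp n (nbc k j x) + (if n + j = 0 then (1 : ℂ) else 0) • bOp k x := by
  have h : cOp j (bOp n x) = (if n + j = 0 then (1 : ℂ) else 0) • x - bOp n (cOp j x) := by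
    rw [bOp_cOp]; abel
  rw [nbc_apply, nbc_apply, h, map_sub, map_sub, map_smul, map_smul, bOp_bOp k n]
  abel

theorem nbc_cOp (k j n : ℤ) (x : FockF) :
    nbc k j (cOp n x) = cOp n (nbc k j x) - (if k + n = 0 then (1 : ℂ) else 0) • cOp j x := by
  rw [nbc_apply, nbc_apply, cOp_cOp j n, map_neg, bOp_cOp k n, map_sub, map_smul]
  abel

theorem finite_contractLeft_ne_zero (x : FockF) :
    {i | CliffordAlgebra.contractLeft (bvDual i) x ≠ 0}.Finite := by
  induction x using CliffordAlgebra.left_induction with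
  | algebraMap r => simp
  | add x y hx hy =>
    refine (hx.union hy).subset fun i hi => ?_
    by_contra h
    simp only [Set.mem_union, Set.mem_ofPred_eq, not_or, not_not] at h
    exact hi (by rw [map_add, h.1, h.2, add_zero])
  | ι_mul x v hx =>
    refine (hx.union v.hasFiniteSupport).subset fun i hi => ?_
    by_contra h
    simp only [Set.mem_union, Set.mem_ofPred_eq, not_or, not_not, Function.mem_support] at h
    refine hi ?_
    rw [CliffordAlgebra.contractLeft_ι_mul, h.1, mul_zero, sub_zero]
    simp [bvDual, h.2]

theorem finite_nbc_ne_zero (m : ℤ) (x : FockF) : {k | nbc k (m - k) x ≠ 0}.Finite := by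
  have hx := finite_contractLeft_ne_zero x
  have h₁ : {k : ℤ | 1 ≤ k ∧ bOp k x ≠ 0}.Finite := by
    refine Set.Finite.of_finite_image (f := fun k : ℤ => (Sum.inr (k - 1).toNat : BCIndex))
      (hx.subset ?_) ?_
    · rintro _ ⟨k, ⟨hk, hk'⟩, rfl⟩
      rwa [bOp_of_pos hk] at hk'
    · rintro k ⟨hk, -⟩ l ⟨hl, -⟩ h
      have := Sum.inr.inj h
      lia
  have h₂ : {k : ℤ | 0 ≤ m - k ∧ cOp (m - k) x ≠ 0}.Finite := by
    refine Set.Finite.of_finite_image (f := fun k : ℤ => (Sum.inl (m - k).toNat : BCIndex))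
      (hx.subset ?_) ?_
    · rintro _ ⟨k, ⟨hk, hk'⟩, rfl⟩
      rwa [cOp_of_nonneg hk] at hk'
    · rintro k ⟨hk, -⟩ l ⟨hl, -⟩ h
      have := Sum.inl.inj h
      lia
  refine ((h₁.union h₂).union (Set.finite_Icc m 0)).subset fun k hk => ?_
  simp only [Set.mem_union, Set.mem_ofPred_eq, Set.mem_Icc]
  by_cases h : 1 ≤ k ∧ m - k ≤ -1
  · refine Or.inl (Or.inl ⟨h.1, fun h0 => hk ?_⟩)
    simp [nbc, h, h0]
  · by_cases hj : 0 ≤ m - k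
    · refine Or.inl (Or.inr ⟨hj, fun h0 => hk ?_⟩)
      rw [nbc, if_neg h, LinearMap.comp_apply, h0, map_zero]
    · exact Or.inr (by lia)

theorem finite_support_smul_nbc (f : ℤ → ℂ) (m : ℤ) (x : FockF) :
    (Function.support fun k : ℤ => f k • nbc k (m - k) x).Finite :=
  (finite_nbc_ne_zero m x).subset fun _ hk h0 => hk (by simp [h0])

/-- The mode of degree `m` of a charge-preserving normally ordered quadratic field:
`x ↦ Σ_k f(k)·:b(k)c(m−k):·x`. -/
def quadMode (f : ℤ → ℂ) (m : ℤ) : Module.End ℂ FockF where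
  toFun x := ∑ᶠ k : ℤ, f k • nbc k (m - k) x
  map_add' x y := by
    rw [← finsum_add_distrib (finite_support_smul_nbc f m x) (finite_support_smul_nbc f m y)]
    simp only [map_add, smul_add]
  map_smul' r x := by
    rw [RingHom.id_apply, smul_finsum' r (finite_support_smul_nbc f m x)]
    simp only [map_smul, smul_comm r]

theorem quadMode_apply (f : ℤ → ℂ) (m : ℤ) (x : FockF) :
    quadMode f m x = ∑ᶠ k : ℤ, f k • nbc k (m - k) x := rfl

theorem map_quadMode {M : Type*} [AddCommGroup M] [Module ℂ M] (T : FockF →ₗ[ℂ] M)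
    (f : ℤ → ℂ) (m : ℤ) (x : FockF) :
    T (quadMode f m x) = ∑ᶠ k : ℤ, f k • T (nbc k (m - k) x) := by
  rw [quadMode_apply, ← LinearMap.toAddMonoidHom_coe,
    AddMonoidHom.map_finsum _ (finite_support_smul_nbc f m x)]
  simp

theorem quadMode_bOp (f : ℤ → ℂ) (m n : ℤ) (x : FockF) :
    quadMode f m (bOp n x) = bOp n (quadMode f m x) + f (m + n) • bOp (m + n) x := by
  have hsub : (Function.support fun k : ℤ =>
      f k • ((if n + (m - k) = 0 then (1 : ℂ) else 0) • bOp k x)) ⊆ {m + n} := by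
    intro k hk
    by_contra h
    rw [Set.mem_singleton_iff] at h
    exact hk (by simp [show ¬ n + (m - k) = 0 by lia])
  have hfin : (Function.support fun k : ℤ => f k • bOp n (nbc k (m - k) x)).Finite :=
    (finite_nbc_ne_zero m x).subset fun _ hk h0 => hk (by simp [h0])
  rw [map_quadMode, quadMode_apply]
  simp only [nbc_bOp, smul_add]
  rw [finsum_add_distrib hfin ((Set.finite_singleton _).subset hsub),
    finsum_eq_single (fun k : ℤ =>
      f k • ((if n + (m - k) = 0 then (1 : ℂ) else 0) • bOp k x)) (m + n)]
  · simp
  · intro k hk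
    simp [show ¬ n + (m - k) = 0 by lia]

theorem quadMode_cOp (f : ℤ → ℂ) (m n : ℤ) (x : FockF) :
    quadMode f m (cOp n x) = cOp n (quadMode f m x) - f (-n) • cOp (m + n) x := by
  have hsub : (Function.support fun k : ℤ =>
      f k • ((if k + n = 0 then (1 : ℂ) else 0) • cOp (m - k) x)) ⊆ {-n} := by
    intro k hk
    by_contra h
    rw [Set.mem_singleton_iff] at h
    exact hk (by simp [show ¬ k + n = 0 by lia])
  have hfin : (Function.support fun k : ℤ => f k • cOp n (nbc k (m - k) x)).Finite :=
    (finite_nbc_ne_zero m x).subset fun _ hk h0 => hk (by simp [h0])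
  rw [map_quadMode, quadMode_apply]
  simp only [nbc_cOp, smul_sub]
  rw [finsum_sub_distrib hfin ((Set.finite_singleton _).subset hsub),
    finsum_eq_single (fun k : ℤ =>
      f k • ((if k + n = 0 then (1 : ℂ) else 0) • cOp (m - k) x)) (-n)]
  · simp
  · intro k hk
    simp [show ¬ k + n = 0 by lia]

/-- The vacuum expectation functional. -/
abbrev vacuumExp : FockF →ₐ[ℂ] ℂ := algebraMapInv

theorem vacuumExp_bOp {k : ℤ} (h : k ≤ 0) (x : FockF) : vacuumExp (bOp k x) = 0 := by
  simp [bOp_of_nonpos h, algebraMapInv]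

theorem vacuumExp_cOp {j : ℤ} (h : j ≤ -1) (x : FockF) : vacuumExp (cOp j x) = 0 := by
  simp [cOp_of_neg h, algebraMapInv]

theorem bOp_one {k : ℤ} (h : 1 ≤ k) : bOp k 1 = 0 := by
  rw [bOp_of_pos h, CliffordAlgebra.contractLeft_one]

theorem cOp_one {j : ℤ} (h : 0 ≤ j) : cOp j 1 = 0 := by
  rw [cOp_of_nonneg h, CliffordAlgebra.contractLeft_one]

theorem vacuumExp_quadMode (f : ℤ → ℂ) {m : ℤ} (hm : m ≤ 0) (x : FockF) :
    vacuumExp (quadMode f m x) = 0 := by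
  refine (map_quadMode vacuumExp.toLinearMap f m x).trans ?_
  refine finsum_eq_zero_of_forall_eq_zero fun k => ?_
  rw [AlgHom.toLinearMap_apply]
  by_cases h : 1 ≤ k ∧ m - k ≤ -1
  · simp [nbc, h, vacuumExp_cOp h.2]
  · rw [nbc, if_neg h, LinearMap.comp_apply, vacuumExp_bOp (by lia), smul_zero]

theorem quadMode_one (f : ℤ → ℂ) (m : ℤ) :
    quadMode f m 1 = ∑ k ∈ Finset.Ioc m 0, f k • bOp k (cOp (m - k) 1) := by
  rw [quadMode_apply, finsum_eq_sum_of_support_subset (s := Finset.Ioc m 0)]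
  · refine Finset.sum_congr rfl fun k hk => ?_
    rw [Finset.mem_Ioc] at hk
    simp [nbc, show ¬ 1 ≤ k by lia]
  · intro k hk
    by_contra hk'
    rw [Finset.coe_Ioc, Set.mem_Ioc] at hk'
    refine hk ?_
    by_cases h : 1 ≤ k ∧ m - k ≤ -1
    · simp [nbc, h, bOp_one h.1]
    · simp only [nbc, if_neg h, LinearMap.comp_apply, cOp_one (show 0 ≤ m - k by lia), map_zero,
        smul_zero]

theorem quadMode_one_of_nonneg (f : ℤ → ℂ) {m : ℤ} (hm : 0 ≤ m) : quadMode f m 1 = 0 := by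
  rw [quadMode_one, Finset.Ioc_eq_empty (by lia), Finset.sum_empty]

/-- The Schwinger term of two quadratic fields. -/
theorem vacuumExp_quadMode_quadMode (f g : ℤ → ℂ) (m n : ℤ) :
    vacuumExp (quadMode f m (quadMode g n 1)) =
      if m + n = 0 then ∑ k ∈ Finset.Ioc n 0, g k * f (m + k) else 0 := by
  have h : ∀ k ∈ Finset.Ioc n 0, vacuumExp (quadMode f m (g k • bOp k (cOp (n - k) 1))) =
      if m + n = 0 then g k * f (m + k) else 0 := by
    intro k hk
    rw [Finset.mem_Ioc] at hk
    rw [map_smul, map_smul, quadMode_bOp, map_add, vacuumExp_bOp hk.2, map_smul, bOp_cOp,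
      map_sub, vacuumExp_cOp (by lia), map_smul, map_one, show m + k + (n - k) = m + n by ring]
    split_ifs <;> simp
  rw [quadMode_one, map_sum, map_sum, Finset.sum_congr rfl h]
  split_ifs <;> simp

/-- Setting the coordinate `i` to zero, extended to the exterior algebra. -/
theorem map_erase_apply (i : BCIndex) (x : FockF) :
    ExteriorAlgebra.map (LinearMap.id - (bvDual i).smulRight (bv i)) x =
      x - ι ℂ (bv i) * CliffordAlgebra.contractLeft (bvDual i) x := by
  induction x using CliffordAlgebra.left_induction with
  | algebraMap r => simp
  | add x y hx hy => simp only [map_add, mul_add, hx, hy]; abel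
  | ι_mul x v hx =>
    have e : (CliffordAlgebra.ι (0 : QuadraticForm ℂ BCSpace)) v = ι ℂ v := rfl
    rw [map_mul, hx, CliffordAlgebra.contractLeft_ι_mul, e, map_apply_ι]
    have h1 : ι ℂ v * (ι ℂ (bv i) * CliffordAlgebra.contractLeft (bvDual i) x) =
        -(ι ℂ (bv i) * (ι ℂ v * CliffordAlgebra.contractLeft (bvDual i) x)) :=
      eq_neg_of_add_eq_zero_left (ι_mul_ι_mul _ _ _)
    have h2 : ι ℂ (bv i) * (ι ℂ (bv i) * CliffordAlgebra.contractLeft (bvDual i) x) = 0 := by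
      rw [← mul_assoc, ι_sq_zero, zero_mul]
    simp only [LinearMap.sub_apply, LinearMap.id_apply, LinearMap.smulRight_apply, map_sub,
      map_smul, sub_mul, mul_sub, smul_mul_assoc, mul_smul_comm, h1, h2, smul_zero]
    abel

theorem eq_algebraMap_of_contractLeft_eq_zero {y : FockF}
    (hy : ∀ i, CliffordAlgebra.contractLeft (bvDual i) y = 0) :
    y = algebraMap ℂ FockF (vacuumExp y) := by
  classical
  let p (S : Finset BCIndex) : BCSpace →ₗ[ℂ] BCSpace :=
    Finsupp.lsum ℂ fun i => if i ∈ S then 0 else Finsupp.lsingle i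
  have hfix (S : Finset BCIndex) : ExteriorAlgebra.map (p S) y = y := by
    induction S using Finset.induction_on with
    | empty =>
      have : p ∅ = LinearMap.id := by ext; simp [p]
      rw [this, map_id, AlgHom.id_apply]
    | insert i S hi ih =>
      have : p (insert i S) = p S ∘ₗ (LinearMap.id - (bvDual i).smulRight (bv i)) := by
        ext j : 2
        by_cases hj : j = i
        · subst hj
          simp [p, bvDual, bv]
        · simp [p, bvDual, bv, hj]
      rw [this, ← map_comp_map, AlgHom.comp_apply, map_erase_apply, hy, mul_zero, sub_zero, ih]
  have hkill (x : FockF) : ∃ S₀ : Finset BCIndex, ∀ S, S₀ ⊆ S →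
      ExteriorAlgebra.map (p S) x = algebraMap ℂ FockF (vacuumExp x) := by
    induction x using ExteriorAlgebra.induction with
    | algebraMap r => exact ⟨∅, fun S _ => by simp⟩
    | ι v =>
      refine ⟨v.support, fun S hS => ?_⟩
      have : p S v = 0 := by
        simp only [p, Finsupp.lsum_apply, Finsupp.sum]
        exact Finset.sum_eq_zero fun i hi => by simp [hS hi]
      simp [this, algebraMapInv]
    | mul a b ha hb =>
      obtain ⟨A, hA⟩ := ha
      obtain ⟨B, hB⟩ := hb
      exact ⟨A ∪ B, fun S hS => by
        rw [map_mul, hA S (Finset.union_subset_left hS), hB S (Finset.union_subset_right hS),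
          map_mul, map_mul]⟩
    | add a b ha hb =>
      obtain ⟨A, hA⟩ := ha
      obtain ⟨B, hB⟩ := hb
      exact ⟨A ∪ B, fun S hS => by
        rw [map_add, hA S (Finset.union_subset_left hS), hB S (Finset.union_subset_right hS),
          map_add, map_add]⟩
  obtain ⟨S, hS⟩ := hkill y
  rw [← hS S subset_rfl, hfix]

/-- Schur's lemma for the Fock space: an operator commuting with all modes of `b` and `c`
and with zero vacuum expectation vanishes. -/
theorem eq_zero_of_commute_modes {D : Module.End ℂ FockF}
    (hb : ∀ n x, D (bOp n x) = bOp n (D x)) (hc : ∀ n x, D (cOp n x) = cOp n (D x))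
    (h1 : vacuumExp (D 1) = 0) : D = 0 := by
  have hvac : D 1 = 0 := by
    rw [eq_algebraMap_of_contractLeft_eq_zero (y := D 1), h1, map_zero]
    rintro (n | n)
    · have := hc n 1
      rw [cOp_one (by lia), map_zero, cOp_of_nonneg (by lia)] at this
      simpa using this.symm
    · have := hb (n + 1) 1
      rw [bOp_one (by lia), map_zero, bOp_of_pos (by lia)] at this
      simpa using this.symm
  have hbv (i : BCIndex) (x : FockF) : D (ι ℂ (bv i) * x) = ι ℂ (bv i) * D x := by
    rcases i with n | n
    · simpa [bOp_of_nonpos (show -(n : ℤ) ≤ 0 by lia)] using hb (-n) x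
    · simpa [cOp_of_neg (show -(n : ℤ) - 1 ≤ -1 by lia)] using hc (-n - 1) x
  have hι (v : BCSpace) (x : FockF) : D (ι ℂ v * x) = ι ℂ v * D x := by
    induction v using Finsupp.induction_linear with
    | zero => simp
    | add v w hv hw => simp only [map_add, add_mul, hv, hw]
    | single i a =>
      have : Finsupp.single i a = a • bv i := by simp [bv]
      rw [this, map_smul, smul_mul_assoc, map_smul, hbv, smul_mul_assoc]
  refine LinearMap.ext fun x => ?_
  rw [LinearMap.zero_apply]
  induction x using CliffordAlgebra.left_induction with
  | algebraMap r =>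
    rw [Algebra.algebraMap_eq_smul_one, map_smul]
    exact (congrArg _ hvac).trans (smul_zero r)
  | add x y hx hy => rw [map_add, hx, hy, add_zero]
  | ι_mul x v hx => exact (hι v x).trans (by rw [hx, mul_zero])

/-- The commutator of two quadratic modes, given the bracket of their symbols and the vanishing
of the Schwinger term. -/
theorem quadMode_commutator {f g h : ℤ → ℂ} {m n : ℤ} {s : ℂ}
    (hsymb : ∀ p, f p * g (p - m) - g p * f (p - n) = s * h p)
    (hfg : m + n = 0 → ∑ k ∈ Finset.Ioc n 0, g k * f (m + k) = 0)
    (hgf : m + n = 0 → ∑ k ∈ Finset.Ioc m 0, f k * g (n + k) = 0) (x : FockF) :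
    quadMode f m (quadMode g n x) - quadMode g n (quadMode f m x) =
      s • quadMode h (m + n) x := by
  suffices H : quadMode f m * quadMode g n - quadMode g n * quadMode f m -
      s • quadMode h (m + n) = 0 by
    simpa [sub_eq_zero] using LinearMap.congr_fun H x
  refine eq_zero_of_commute_modes (fun k x => ?_) (fun k x => ?_) ?_
  · have e := hsymb (m + n + k)
    rw [show m + n + k - m = n + k by ring, show m + n + k - n = m + k by ring] at e
    simp only [LinearMap.sub_apply, Module.End.mul_apply, LinearMap.smul_apply, quadMode_bOp,
      map_add, map_sub, map_smul, smul_add, ← add_assoc, add_comm n m]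
    linear_combination (norm := module) e • bOp (m + n + k) x
  · have e := hsymb (-k)
    rw [show -k - m = -m + -k by ring, show -k - n = -n + -k by ring] at e
    simp only [LinearMap.sub_apply, Module.End.mul_apply, LinearMap.smul_apply, quadMode_cOp,
      map_sub, map_smul, smul_sub, ← add_assoc, add_comm n m, neg_add]
    linear_combination (norm := module) -e • cOp (m + n + k) x
  · have hs : vacuumExp (quadMode h (m + n) 1) = 0 := by
      rcases le_total (m + n) 0 with hmn | hmn
      · exact vacuumExp_quadMode h hmn 1
      · rw [quadMode_one_of_nonneg h hmn, map_zero]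
    simp only [LinearMap.sub_apply, Module.End.mul_apply, LinearMap.smul_apply, map_sub, map_smul,
      hs, vacuumExp_quadMode_quadMode, add_comm n m]
    split_ifs with h0
    · simp [hfg h0, hgf h0]
    · simp

theorem sum_Ioc_cubic_eq_zero (m : ℤ) :
    ∑ k ∈ Finset.Ioc (-m) 0, (k : ℂ) * (k + m) * (2 * k + m) = 0 := by
  have h : ∑ k ∈ Finset.Ioc (-m) 0, (k : ℂ) * (k + m) * (2 * k + m) =
      ∑ k ∈ Finset.Ioo (-m) 0, (k : ℂ) * (k + m) * (2 * k + m) := by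
    refine (Finset.sum_subset (fun k hk => ?_) fun k hk hk' => ?_).symm
    · simp only [Finset.mem_Ioo, Finset.mem_Ioc] at *; lia
    · simp only [Finset.mem_Ioo, Finset.mem_Ioc] at *
      simp [show k = 0 by lia]
  have hneg : ∑ k ∈ Finset.Ioo (-m) 0, (k : ℂ) * (k + m) * (2 * k + m) =
      ∑ k ∈ Finset.Ioo (-m) 0, -((k : ℂ) * (k + m) * (2 * k + m)) := by
    refine Finset.sum_nbij' (fun k => -m - k) (fun k => -m - k) ?_ ?_ ?_ ?_ ?_
    · intro k hk; simp only [Finset.mem_Ioo] at *; lia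
    · intro k hk; simp only [Finset.mem_Ioo] at *; lia
    · intro k _; ring
    · intro k _; ring
    · intro k _; push_cast; ring
  rw [h]
  rw [Finset.sum_neg_distrib] at hneg
  exact self_eq_neg.mp hneg

/-- `W̃(z)` is a primary field of conformal weight `3` for the Virasoro field `T(z)`:
`[L_m, W̃_n] = (2m − n)·W̃_{m+n}`. -/
theorem L_W_commutator (m n : ℤ) (x : FockF) :
    Lmode m (Wmode n x) - Wmode n (Lmode m x)
      = ((2 * m - n : ℤ) : ℂ) • Wmode (m + n) x := by
  refine quadMode_commutator (f := fun k => (-k : ℂ))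
    (g := fun k => (1 / 2 : ℂ) * k * (2 * k - n))
    (h := fun k => (1 / 2 : ℂ) * k * (2 * k - (m + n : ℤ)))
    (fun p => ?_) (fun h0 => ?_) (fun h0 => ?_) x
  · push_cast
    ring
  · obtain rfl : n = -m := by lia
    rw [← mul_zero (-1 / 2 : ℂ), ← sum_Ioc_cubic_eq_zero m, Finset.mul_sum]
    refine Finset.sum_congr rfl fun k _ => ?_
    push_cast
    ring
  · obtain rfl : m = -n := by lia
    rw [← mul_zero (-1 / 2 : ℂ), ← sum_Ioc_cubic_eq_zero n, Finset.mul_sum]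
    refine Finset.sum_congr rfl fun k _ => ?_
    push_cast
    ring
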